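/- Let (J₁, J₂) be a linear generalized Kähler structure on 𝕍 = V × V* with G = −J₁∘J₂ and let K ⊆ V* be any subspace. Then 𝕍 = Ann(K + J₁(K) + J₂(K) + G(K)) ⊕ (K + J₁(K) + J₂(K) + G(K)), and for {j, l} = {1, 2} (j ≠ l) also 𝕍 = Ann(K + J_j(K)) ⊕ (J_l(K) + G(K)), both as internal direct sums. (The decompositions of equation (kahler:decomp).) -/

import Mathlib

/-- The generalized tangent space `𝕍 = V × V*`. -/
abbrev GV (V : Type*) [AddCommGroup V] [Module ℝ V] := V × Module.Dual ℝ V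

variable (V : Type*) [AddCommGroup V] [Module ℝ V] [FiniteDimensional ℝ V]

/-- The canonical symmetric pairing `⟨(X,ξ),(Y,η)⟩ = (1/2)(η X + ξ Y)` on `𝕍`. -/
noncomputable def pairForm : LinearMap.BilinForm ℝ (GV V) :=
  LinearMap.mk₂ ℝ (fun u v => (1 / 2 : ℝ) * (v.2 u.1 + u.2 v.1))
    (fun u u' v => by simp; ring)
    (fun c u v => by simp; ring)
    (fun u v v' => by simp; ring)
    (fun c u v => by simp; ring)

/-- `V* = {0} × V*` as a subspace of `𝕍`. -/
def VStar : Submodule ℝ (GV V) := LinearMap.range (LinearMap.inr ℝ V (Module.Dual ℝ V))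

variable {V}

/-- The annihilator of a subspace of `𝕍` with respect to the canonical pairing. -/
noncomputable def Ann (S : Submodule ℝ (GV V)) : Submodule ℝ (GV V) where
  carrier := {u : GV V | ∀ s ∈ S, pairForm V u s = 0}
  add_mem' := fun ha hb s hs => by simp [ha s hs, hb s hs]
  zero_mem' := fun s hs => by simp
  smul_mem' := fun c a ha s hs => by simp [ha s hs]

/-- The image in `𝕍` of a subspace `K ⊆ V*`. -/
def ofDual (K : Submodule ℝ (Module.Dual ℝ V)) : Submodule ℝ (GV V) :=
  K.map (LinearMap.inr ℝ V (Module.Dual ℝ V))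

/-- A linear generalized complex structure on `𝕍`. -/
structure IsGenCx (J : GV V →ₗ[ℝ] GV V) : Prop where
  sq : ∀ u, J (J u) = -u
  orth : ∀ u v, pairForm V (J u) (J v) = pairForm V u v

/-- A linear generalized Kähler structure on `𝕍`: two commuting linear generalized
complex structures such that `G = -J₁∘J₂` gives a positive definite form `⟨G·,·⟩`. -/
structure IsGenKahler (J₁ J₂ : GV V →ₗ[ℝ] GV V) : Prop where
  cx1 : IsGenCx J₁
  cx2 : IsGenCx J₂
  comm : ∀ u, J₁ (J₂ u) = J₂ (J₁ u)
  posdef : ∀ u : GV V, u ≠ 0 → 0 < pairForm V (-(J₁ (J₂ u))) u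

theorem pairForm_comm {V : Type*} [AddCommGroup V] [Module ℝ V] (u v : GV V) :
    pairForm V u v = pairForm V v u := by
  simp only [pairForm, LinearMap.mk₂_apply]
  ring

/-- If `G` preserves the pairing, squares to the identity and `⟨G·,·⟩` is positive definite, then
`G W` is complementary to the annihilator of `W`. -/
theorem isCompl_Ann_map {V : Type*} [AddCommGroup V] [Module ℝ V] [FiniteDimensional ℝ V]
    (G : GV V →ₗ[ℝ] GV V) (hsq : ∀ u, G (G u) = u)
    (horth : ∀ u v, pairForm V (G u) (G v) = pairForm V u v)
    (hpos : ∀ u, u ≠ 0 → 0 < pairForm V (G u) u) (W : Submodule ℝ (GV V)) :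
    IsCompl (Ann W) (W.map G) := by
  let B : LinearMap.BilinForm ℝ (GV V) := (pairForm V).comp G LinearMap.id
  have hB : ∀ u v, B u v = pairForm V (G u) v := fun _ _ => rfl
  have hrefl : B.IsRefl := by
    intro u v huv
    rw [hB] at huv ⊢
    rw [← horth, hsq, pairForm_comm, huv]
  have hAnn : Ann W = B.orthogonal (W.map G) := by
    ext u
    constructor
    · rintro hu _ ⟨w, hw, rfl⟩
      change B (G w) u = 0
      rw [hB, hsq, pairForm_comm]
      exact hu w hw
    · intro hu w hw
      have h0 : B (G w) u = 0 := hu _ (Submodule.mem_map_of_mem hw)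
      rwa [hB, hsq, pairForm_comm] at h0
  rw [hAnn]
  refine ((LinearMap.BilinForm.isCompl_orthogonal_iff_disjoint hrefl).2 ?_).symm
  rw [Submodule.disjoint_def]
  intro u hu hu'
  by_contra hne
  have h0 : B u u = 0 := hu' u hu
  exact (hpos u hne).ne' h0

/-- equation (kahler:decomp): for any `K ⊆ V*`,
`𝕍 = Ann(K + J₁K + J₂K + GK) ⊕ (K + J₁K + J₂K + GK)` and, for `{j,l} = {1,2}`,
`𝕍 = Ann(K + J_jK) ⊕ (J_lK + GK)`, all as internal direct sums. -/
theorem statement4 {V : Type*} [AddCommGroup V] [Module ℝ V] [FiniteDimensional ℝ V]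
    (J₁ J₂ : GV V →ₗ[ℝ] GV V) (h : IsGenKahler J₁ J₂)
    (K : Submodule ℝ (Module.Dual ℝ V)) :
    let G : GV V →ₗ[ℝ] GV V := -(J₁ ∘ₗ J₂)
    let Kv : Submodule ℝ (GV V) := ofDual K
    let S : Submodule ℝ (GV V) := Kv ⊔ Kv.map J₁ ⊔ Kv.map J₂ ⊔ Kv.map G
    (Ann S ⊓ S = ⊥ ∧ Ann S ⊔ S = ⊤) ∧
    (Ann (Kv ⊔ Kv.map J₁) ⊓ (Kv.map J₂ ⊔ Kv.map G) = ⊥ ∧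
      Ann (Kv ⊔ Kv.map J₁) ⊔ (Kv.map J₂ ⊔ Kv.map G) = ⊤) ∧
    (Ann (Kv ⊔ Kv.map J₂) ⊓ (Kv.map J₁ ⊔ Kv.map G) = ⊥ ∧
      Ann (Kv ⊔ Kv.map J₂) ⊔ (Kv.map J₁ ⊔ Kv.map G) = ⊤) := by
  intro G Kv S
  have hG : ∀ u, G u = -J₁ (J₂ u) := fun _ => rfl
  have hG₁ : ∀ u, G (J₁ u) = J₂ u := fun u => by rw [hG, ← h.comm, h.cx1.sq, neg_neg]
  have hG₂ : ∀ u, G (J₂ u) = J₁ u := fun u => by rw [hG, h.cx2.sq, map_neg, neg_neg]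
  have hsq : ∀ u, G (G u) = u := fun u => by
    rw [hG u, map_neg, hG₁, h.cx2.sq, neg_neg]
  have horth : ∀ u v, pairForm V (G u) (G v) = pairForm V u v := fun u v => by
    simp [hG, h.cx1.orth, h.cx2.orth]
  have key := isCompl_Ann_map G hsq horth h.posdef
  have m₁ : (Kv.map J₁).map G = Kv.map J₂ := by
    rw [← Submodule.map_comp, show G ∘ₗ J₁ = J₂ from LinearMap.ext hG₁]
  have m₂ : (Kv.map J₂).map G = Kv.map J₁ := by
    rw [← Submodule.map_comp, show G ∘ₗ J₂ = J₁ from LinearMap.ext hG₂]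
  have m₃ : (Kv.map G).map G = Kv := by
    rw [← Submodule.map_comp, show G ∘ₗ G = LinearMap.id from LinearMap.ext hsq,
      Submodule.map_id]
  have hS : S.map G = S := by
    simp only [S, Submodule.map_sup, m₁, m₂, m₃]
    ac_rfl
  have k₀ := key S
  have k₁ := key (Kv ⊔ Kv.map J₁)
  have k₂ := key (Kv ⊔ Kv.map J₂)
  rw [hS] at k₀
  rw [Submodule.map_sup, m₁, sup_comm (Kv.map G)] at k₁
  rw [Submodule.map_sup, m₂, sup_comm (Kv.map G)] at k₂
  exact ⟨⟨k₀.inf_eq_bot, k₀.sup_eq_top⟩, ⟨k₁.inf_eq_bot, k₁.sup_eq_top⟩,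
    k₂.inf_eq_bot, k₂.sup_eq_top⟩
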